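/- Let (S⊥, 3) be a basic C-set. Then the only operation * : S⊥ × S⊥ → 3 making (S⊥, 3) an agreeable C-set is: s*t = T if s = t and s ≠ ⊥ ≠ t; s*t = F if s ≠ t and s ≠ ⊥ ≠ t; s*t = U if s = ⊥ or t = ⊥. -/

import Mathlib

universe u

/-- The three-element ada 3 = {T, F, U} of McCarthy's three-valued logic. -/
inductive Three : Type where
  | T : Three
  | F : Three
  | U : Three
deriving DecidableEq, Repr

namespace Three

/-- Negation: ¬T = F, ¬F = T, ¬U = U. -/
def tnot : Three → Three
  | T => F
  | F => T
  | U => U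

/-- Sequential conjunction: T ∧ x = x, F ∧ x = F, U ∧ x = U. -/
def tand : Three → Three → Three
  | T, x => x
  | F, _ => F
  | U, _ => U

/-- Sequential disjunction: T ∨ x = T, F ∨ x = x, U ∨ x = U. -/
def tor : Three → Three → Three
  | T, _ => T
  | F, x => x
  | U, _ => U

/-- The ada operation: T↓ = T, F↓ = U↓ = F. -/
def tdown : Three → Three
  | T => T
  | F => F
  | U => F

end Three

/-- The basic C-set action of 3 on a pointed set: T[a,b] = a, F[a,b] = b, U[a,b] = ⊥. -/
def bact {S : Type u} (bot : S) : Three → S → S → S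
  | Three.T, a, _ => a
  | Three.F, _, b => b
  | Three.U, _, _ => bot

/-- On a basic C-set (S⊥, 3), the operation given by
s*t = T if s = t (≠ ⊥), s*t = F if s ≠ t (≠ ⊥), s*t = U if s = ⊥ or t = ⊥,
is the only operation * : S⊥ × S⊥ → 3 making (S⊥, 3) an agreeable C-set. -/
theorem basic_agreeable_unique (S : Type u) (bot : S) (star : S → S → Three)
    (domain_ax : ∀ s, bact bot (star s s) s bot = s)
    (bot_star : ∀ s, star bot s = Three.U)
    (star_bot : ∀ s, star s bot = Three.U)
    (eq_concl : ∀ s t, bact bot (star s t) s t = bact bot (star s t) t t)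
    (op_interchange : ∀ (α : Three) (s t u v : S),
      star (bact bot α s t) (bact bot α u v) =
        Three.tor (Three.tand α (star s u)) (Three.tand (Three.tnot α) (star t v)))
    (totality : ∀ s t, star s s = Three.T → star s t = Three.U → t = bot) :
    ∀ s t : S,
      (s = bot ∨ t = bot → star s t = Three.U) ∧
      (s ≠ bot → t ≠ bot → s = t → star s t = Three.T) ∧
      (s ≠ bot → t ≠ bot → s ≠ t → star s t = Three.F) := by
  have hself : ∀ s, s ≠ bot → star s s = Three.T := by
    intro s hs
    have h := domain_ax s
    cases hss : star s s with
    | T => rfl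
    | F => rw [hss] at h; exact absurd h.symm hs
    | U => rw [hss] at h; exact absurd h.symm hs
  intro s t
  refine ⟨?_, ?_, ?_⟩
  · rintro (rfl | rfl)
    · exact bot_star t
    · exact star_bot s
  · rintro hs _ rfl
    exact hself s hs
  · intro hs ht hst
    have h := eq_concl s t
    cases hh : star s t with
    | T => rw [hh] at h; exact absurd h hst
    | F => rfl
    | U => exact absurd (totality s t (hself s hs) hh) ht
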